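/- Let Γ be a finite connected non-complete graph of prime valency p that is 2-geodesic transitive but not 2-arc transitive, and let v be a vertex of Γ. Then the stabiliser A_v of v in A = Aut Γ acts faithfully on the neighbourhood Γ(v), and |A_v| = p(p-1)/2. -/

import Mathlib

open SimpleGraph

/-- `Γ` is arc transitive: its automorphism group is transitive on ordered pairs
of adjacent vertices. -/
def ArcTransitive {V : Type*} (Γ : SimpleGraph V) : Prop :=
  ∀ ⦃v u v' u' : V⦄, Γ.Adj v u → Γ.Adj v' u' →
    ∃ φ : Γ ≃g Γ, φ v = v' ∧ φ u = u'

/-- `(v,u,w)` is a 2-arc of `Γ`. -/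
def Is2Arc {V : Type*} (Γ : SimpleGraph V) (v u w : V) : Prop :=
  Γ.Adj v u ∧ Γ.Adj u w ∧ v ≠ w

/-- `(v,u,w)` is a 2-geodesic of `Γ`: a 2-arc with `v`, `w` non-adjacent. -/
def Is2Geodesic {V : Type*} (Γ : SimpleGraph V) (v u w : V) : Prop :=
  Γ.Adj v u ∧ Γ.Adj u w ∧ v ≠ w ∧ ¬ Γ.Adj v w

/-- `Γ` is 2-arc transitive: arc transitive and transitive on 2-arcs. -/
def TwoArcTransitive {V : Type*} (Γ : SimpleGraph V) : Prop :=
  ArcTransitive Γ ∧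
  ∀ ⦃v u w v' u' w' : V⦄, Is2Arc Γ v u w → Is2Arc Γ v' u' w' →
    ∃ φ : Γ ≃g Γ, φ v = v' ∧ φ u = u' ∧ φ w = w'

/-- `Γ` is 2-geodesic transitive: arc transitive and transitive on 2-geodesics. -/
def TwoGeodesicTransitive {V : Type*} (Γ : SimpleGraph V) : Prop :=
  ArcTransitive Γ ∧
  ∀ ⦃v u w v' u' w' : V⦄, Is2Geodesic Γ v u w → Is2Geodesic Γ v' u' w' →
    ∃ φ : Γ ≃g Γ, φ v = v' ∧ φ u = u' ∧ φ w = w'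

open Polynomial in
/-- If the `j`-th power sums of `D` vanish for `0 < j < r` and the `r`-th one does not, then the
operator `g ↦ ∑ d ∈ D, (g(X + d) - g)` lowers degrees `e` with `r ≤ e < p` by exactly `r`. -/
lemma coeff_sum_taylor_sub_ne_zero {p : ℕ} [Fact p.Prime] {D : Finset (ZMod p)} {r : ℕ}
    (hr : 0 < r) (h0 : ∀ j, 0 < j → j < r → ∑ d ∈ D, d ^ j = 0) (h1 : ∑ d ∈ D, d ^ r ≠ 0)
    {g : (ZMod p)[X]} (hg : g.natDegree < p) (hrg : r ≤ g.natDegree) :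
    (∑ d ∈ D, (taylor d g - g)).coeff (g.natDegree - r) ≠ 0 := by
  obtain ⟨e, he⟩ := Nat.exists_eq_add_of_le' hrg
  have hsub : g.natDegree - r = e := by omega
  have hdeg : (hasseDeriv e g).natDegree < r + 1 := by
    have := natDegree_hasseDeriv_le g e
    omega
  have key : (∑ d ∈ D, (taylor d g - g)).coeff e =
      ((r + e).choose e * g.coeff (r + e)) * ∑ d ∈ D, d ^ r := by
    simp only [Finset.sum_sub_distrib, coeff_sub, finsetSum_coeff, taylor_coeff,
      eval_eq_sum_range' hdeg]
    rw [Finset.sum_comm]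
    simp only [← Finset.mul_sum]
    rw [Finset.sum_range_succ, Finset.sum_eq_single_of_mem 0 (Finset.mem_range.2 hr)]
    · simp [hasseDeriv_coeff]
      ring
    · intro j hj hj0
      rw [h0 j (Nat.pos_of_ne_zero hj0) (Finset.mem_range.1 hj), mul_zero]
  rw [hsub, key]
  refine mul_ne_zero (mul_ne_zero ?_ ?_) h1
  · rw [Ne, ZMod.natCast_eq_zero_iff]
    intro hdvd
    have := (Fact.out : p.Prime).dvd_factorial.1
      (hdvd.trans ((Dvd.intro _ rfl).trans
        (Dvd.intro _ (Nat.choose_mul_factorial_mul_factorial (Nat.le_add_left e r)))))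
    omega
  · have : g.leadingCoeff ≠ 0 := by
      rw [Ne, leadingCoeff_eq_zero]
      rintro rfl
      simp at hrg
      omega
    rwa [leadingCoeff, he, add_comm e r] at this

open Polynomial in
/-- Some power sum of a nonempty set of nonzero field elements does not vanish. -/
lemma exists_sum_pow_ne_zero {F : Type*} [Field F] {D : Finset F} (hD : D.Nonempty)
    (h0 : (0 : F) ∉ D) : ∃ j, 0 < j ∧ j ≤ D.card ∧ ∑ d ∈ D, d ^ j ≠ 0 := by
  classical
  by_contra! hcon
  obtain ⟨d₀, hd₀⟩ := hD
  set q : F[X] := ∏ d ∈ D.erase d₀, (X - C d) with hq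
  have hdeg : q.natDegree < D.card := by
    rw [hq, natDegree_prod_of_monic _ _ fun d _ => monic_X_sub_C d]
    simp only [natDegree_X_sub_C, Finset.sum_const, smul_eq_mul, mul_one]
    exact Finset.card_erase_lt_of_mem hd₀
  have hzero : ∑ d ∈ D, d * q.eval d = 0 := by
    simp only [eval_eq_sum_range' hdeg, Finset.mul_sum]
    rw [Finset.sum_comm]
    refine Finset.sum_eq_zero fun j hj => ?_
    have := hcon (j + 1) j.succ_pos (Finset.mem_range.1 hj)
    rw [← mul_zero (q.coeff j), ← this, Finset.mul_sum]
    exact Finset.sum_congr rfl fun d _ => by ring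
  rw [Finset.sum_eq_single_of_mem d₀ hd₀] at hzero
  · rcases mul_eq_zero.1 hzero with h | h
    · exact h0 (h ▸ hd₀)
    · rw [hq, eval_prod, Finset.prod_eq_zero_iff] at h
      obtain ⟨d, hd, h⟩ := h
      rw [eval_sub, eval_X, eval_C, sub_eq_zero] at h
      exact (Finset.mem_erase.1 hd).1 h.symm
  · intro d hd hne
    rw [hq, eval_prod, Finset.prod_eq_zero (Finset.mem_erase.2 ⟨hne, hd⟩) (by simp), mul_zero]

open Polynomial in
/-- A permutation of `ZMod p` which preserves differences in a small nonempty set of nonzero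
elements is affine. -/
lemma affine_of_preserves_small_difference_set {p : ℕ} [Fact p.Prime] {π : ZMod p → ZMod p}
    (hπ : Function.Injective π) {D : Finset (ZMod p)} (hD : D.Nonempty) (h0 : (0 : ZMod p) ∉ D)
    (hcard : 2 * D.card < p) (h : ∀ i j, j - i ∈ D → π j - π i ∈ D) :
    ∃ a b, ∀ x, π x = a * x + b := by
  classical
  have hp : p.Prime := Fact.out
  have hex := exists_sum_pow_ne_zero hD h0
  obtain ⟨j₀, hj₀, hj₀D, hj₀'⟩ := hex
  have hex : ∃ j, 0 < j ∧ ∑ d ∈ D, d ^ j ≠ 0 := ⟨j₀, hj₀, hj₀'⟩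
  obtain ⟨hr, hr1⟩ := Nat.find_spec hex
  have hr0 : ∀ j, 0 < j → j < Nat.find hex → ∑ d ∈ D, d ^ j = 0 := fun j hj hlt => by
    have := Nat.find_min hex hlt
    push Not at this
    exact this hj
  have hrD : Nat.find hex ≤ D.card := (Nat.find_min' hex ⟨hj₀, hj₀'⟩).trans hj₀D
  generalize Nat.find hex = r at *
  have hsum : ∀ (F : ZMod p → ZMod p) (x : ZMod p),
      ∑ d ∈ D, F (π (x + d) - π x) = ∑ d ∈ D, F d := by
    intro F x
    have hinj : Set.InjOn (fun d => π (x + d) - π x) D := fun a _ b _ hab => by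
      simpa using hπ (sub_left_injective hab)
    have himg : D.image (fun d => π (x + d) - π x) = D := by
      refine Finset.eq_of_subset_of_card_le ?_ (Finset.card_image_of_injOn hinj).ge
      intro y hy
      obtain ⟨d, hd, rfl⟩ := Finset.mem_image.1 hy
      exact h _ _ (by simpa using hd)
    conv_rhs => rw [← himg, Finset.sum_image hinj]
  obtain ⟨f, hfdeg, hf⟩ : ∃ f : (ZMod p)[X], f.natDegree < p ∧ ∀ x, f.eval x = π x := by
    refine ⟨Lagrange.interpolate Finset.univ id π, ?_, fun x =>
      Lagrange.eval_interpolate_at_node π Function.injective_id.injOn (Finset.mem_univ x)⟩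
    have := Lagrange.degree_interpolate_lt (s := Finset.univ) (v := id) π
      Function.injective_id.injOn
    rw [Finset.card_univ, ZMod.card] at this
    rcases eq_or_ne (Lagrange.interpolate Finset.univ id π) 0 with h | h
    · rw [h, natDegree_zero]
      exact hp.pos
    · exact (natDegree_lt_iff_degree_lt h).2 this
  have hfpos : 0 < f.natDegree := by
    rw [Nat.pos_iff_ne_zero]
    intro h
    rw [eq_C_of_natDegree_eq_zero h] at hf
    have : (0 : ZMod p) = 1 := hπ (by rw [← hf, ← hf, eval_C, eval_C])
    exact zero_ne_one this
  have hT : ∀ m, 0 < m → m ≤ r → (f ^ m).natDegree < p →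
      ∑ d ∈ D, (taylor d (f ^ m) - f ^ m) = C (∑ d ∈ D, d ^ m) := by
    intro m hm hmr hdeg
    rw [← sub_eq_zero]
    refine eq_zero_of_natDegree_lt_card_of_eval_eq_zero' _ Finset.univ (fun x _ => ?_) ?_
    · have hpow : ∀ d : ZMod p, (d + π x) ^ m - π x ^ m =
          ∑ j ∈ Finset.range m, (π x ^ (m - (j + 1)) * m.choose (j + 1)) * d ^ (j + 1) := by
        intro d
        rw [add_pow, Finset.sum_range_succ']
        simp only [pow_zero, Nat.sub_zero, Nat.choose_zero_right, Nat.cast_one, one_mul, mul_one,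
          add_sub_cancel_right]
        exact Finset.sum_congr rfl fun j _ => by ring
      have := hsum (fun y => (y + π x) ^ m - π x ^ m) x
      simp only [sub_add_cancel] at this
      simp only [eval_sub, eval_finsetSum, taylor_eval, eval_pow, hf, eval_C]
      rw [this, sub_eq_zero]
      simp only [hpow]
      rw [Finset.sum_comm]
      simp only [← Finset.mul_sum]
      rw [Finset.sum_eq_single_of_mem (m - 1) (Finset.mem_range.2 (by omega))]
      · rw [Nat.sub_add_cancel hm]
        simp
      · intro j hj hne
        rw [Finset.mem_range] at hj
        rw [hr0 (j + 1) j.succ_pos (by omega), mul_zero]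
    · rw [Finset.card_univ, ZMod.card]
      refine lt_of_le_of_lt (natDegree_sub_le_of_le (natDegree_sum_le_of_forall_le D _
        (n := (f ^ m).natDegree) fun d _ => ?_) (natDegree_C _).le) (by simpa using hdeg)
      exact (natDegree_sub_le_of_le (natDegree_taylor _ _).le le_rfl).trans (max_self _).le
  have hexm : ∃ m, r ≤ m * f.natDegree := ⟨r, Nat.le_mul_of_pos_right _ hfpos⟩
  have hmle : Nat.find hexm ≤ r := Nat.find_min' hexm (Nat.le_mul_of_pos_right _ hfpos)
  have hmspec := Nat.find_spec hexm
  have hmmin : ∀ m, m < Nat.find hexm → m * f.natDegree < r := fun m hm => by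
    have := Nat.find_min hexm hm
    omega
  generalize Nat.find hexm = m at *
  have hmpos : 0 < m := by
    rw [Nat.pos_iff_ne_zero]
    rintro rfl
    omega
  have hmdeg : m * f.natDegree < p := by
    rcases Nat.lt_or_ge 1 m with h1 | h1
    · have h2 := hmmin 1 h1
      have h3 := hmmin (m - 1) (by omega)
      have h4 : m * f.natDegree = (m - 1) * f.natDegree + f.natDegree := by
        obtain ⟨k, rfl⟩ := Nat.exists_eq_add_of_le' hmpos
        simp [Nat.succ_mul]
      omega
    · obtain rfl : m = 1 := by omega
      simpa using hfdeg
  rw [← natDegree_pow] at hmdeg hmspec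
  have hne := coeff_sum_taylor_sub_ne_zero hr hr0 hr1 hmdeg hmspec
  rw [hT m hmpos hmle hmdeg, coeff_C] at hne
  have hfr : (f ^ m).natDegree = r := by
    by_contra hcon
    exact hne (if_neg (by omega))
  have hmr : m = r := by
    by_contra hcon
    apply hne
    rw [hr0 m hmpos (by omega), ite_self]
  rw [natDegree_pow, hmr] at hfr
  have hf1 : f.natDegree = 1 := Nat.eq_of_mul_eq_mul_left hr (by omega)
  refine ⟨f.coeff 1, f.coeff 0, fun x => ?_⟩
  conv_lhs => rw [← hf, eq_X_add_C_of_natDegree_le_one hf1.le]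
  simp

/-- A permutation of `ZMod p` which preserves a nontrivial circulant relation is affine. -/
lemma affine_of_preserves_difference_set {p : ℕ} [Fact p.Prime] {π : ZMod p → ZMod p}
    (hπ : Function.Injective π) {D : Finset (ZMod p)} (h0 : (0 : ZMod p) ∉ D)
    (hD : D.Nonempty) (hD' : ∃ d, d ≠ 0 ∧ d ∉ D) (h : ∀ i j, j - i ∈ D ↔ π j - π i ∈ D) :
    ∃ a b, ∀ x, π x = a * x + b := by
  rcases Nat.lt_or_ge (2 * D.card) p with hlt | hge
  · exact affine_of_preserves_small_difference_set hπ hD h0 hlt fun i j => (h i j).1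
  · obtain ⟨d, hd0, hdD⟩ := hD'
    refine affine_of_preserves_small_difference_set (D := (insert 0 D)ᶜ) hπ
      ⟨d, by simp [hd0, hdD]⟩ (by simp) ?_ fun i j hij => ?_
    · rw [Finset.card_compl, Finset.card_insert_of_notMem h0, ZMod.card]
      have := (Fact.out : p.Prime).pos
      omega
    · simp only [Finset.mem_compl, Finset.mem_insert, not_or] at hij ⊢
      exact ⟨fun he => hij.1 (by rw [hπ (sub_eq_zero.1 he), sub_self]),
        fun hm => hij.2 ((h i j).2 hm)⟩

/-- Burnside: in a transitive permutation group of prime degree which is not doubly transitive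
(it preserves a nontrivial binary relation), an element with two fixed points is trivial. -/
lemma eq_one_of_fixes_two {α : Type*} [Finite α] {p : ℕ} (hp : p.Prime) (hα : Nat.card α = p)
    {H : Subgroup (Equiv.Perm α)} (htrans : ∀ a b : α, ∃ h ∈ H, h a = b) {R : α → α → Prop}
    (hirr : ∀ a, ¬ R a a) (hinv : ∀ h ∈ H, ∀ a b, R a b ↔ R (h a) (h b))
    (hR : ∃ a b, R a b) (hR' : ∃ a b, a ≠ b ∧ ¬ R a b)
    {h : Equiv.Perm α} (hh : h ∈ H) {x y : α} (hxy : x ≠ y) (hx : h x = x) (hy : h y = y) :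
    h = 1 := by
  classical
  have : Fact p.Prime := ⟨hp⟩
  have := Fintype.ofFinite α
  have hα' : Fintype.card α = p := by rw [← hα, Nat.card_eq_fintype_card]
  have : MulAction.IsPretransitive H α := ⟨fun a b => by
    obtain ⟨g, hg, hgab⟩ := htrans a b
    exact ⟨⟨g, hg⟩, hgab⟩⟩
  have hdvd : p ∣ Nat.card H := by
    rw [← hα, ← MulAction.index_stabilizer_of_transitive H x]
    exact Subgroup.index_dvd_card _
  obtain ⟨⟨σ, hσH⟩, hσ⟩ := exists_prime_orderOf_dvd_card' p hdvd
  rw [Subgroup.orderOf_mk] at hσ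
  have hcyc : σ.IsCycle := Equiv.Perm.isCycle_of_prime_order'' (hα' ▸ hp) (hσ.trans hα'.symm)
  have hsupp : σ.support = Finset.univ := by
    rw [← Finset.card_eq_iff_eq_univ, ← hcyc.orderOf, hσ, hα']
  have hmove : ∀ a, σ a ≠ a := fun a => by
    rw [← Equiv.Perm.mem_support, hsupp]
    exact Finset.mem_univ a
  let e : ZMod p → α := fun i => (σ ^ i.val) x
  have hpow : ∀ (n : ℕ), e n = (σ ^ n) x := fun n => by
    simp only [e]
    rw [ZMod.val_natCast, ← hσ, pow_mod_orderOf]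
  have hadd : ∀ i j, e (i + j) = (σ ^ i.val) (e j) := fun i j => by
    have : i + j = ((i.val + j.val : ℕ) : ZMod p) := by simp
    rw [this, hpow, pow_add, Equiv.Perm.mul_apply]
  have hsurj : Function.Surjective e := fun b => by
    obtain ⟨n, hn⟩ := (hcyc.sameCycle (hmove x) (hmove b)).exists_nat_pow_eq
    exact ⟨n, (hpow n).trans hn⟩
  have hbij : Function.Bijective e :=
    (Fintype.bijective_iff_surjective_and_card e).2 ⟨hsurj, by rw [ZMod.card, hα']⟩
  let E := Equiv.ofBijective e hbij
  have hRe : ∀ i j, R (e i) (e j) ↔ R (e 0) (e (j - i)) := fun i j => by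
    rw [hinv _ (H.pow_mem hσH i.val) (e 0), ← hadd, ← hadd, add_zero, add_sub_cancel]
  let D : Finset (ZMod p) := Finset.univ.filter fun d => R (e 0) (e d)
  have hmemD : ∀ i j, j - i ∈ D ↔ R (e i) (e j) := fun i j => by
    rw [hRe]
    simp [D]
  let π : ZMod p → ZMod p := fun i => E.symm (h (e i))
  have heπ : ∀ i, e (π i) = h (e i) := fun i => E.apply_symm_apply _
  obtain ⟨a, b, hab⟩ : ∃ a b, ∀ x, π x = a * x + b := by
    refine affine_of_preserves_difference_set (D := D)
      (E.symm.injective.comp (h.injective.comp hbij.injective)) ?_ ?_ ?_ fun i j => ?_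
    · rw [← sub_self (0 : ZMod p), hmemD]
      exact hirr _
    · obtain ⟨s, t, hst⟩ := hR
      obtain ⟨i, rfl⟩ := hsurj s
      obtain ⟨j, rfl⟩ := hsurj t
      exact ⟨j - i, (hmemD i j).2 hst⟩
    · obtain ⟨s, t, hne, hst⟩ := hR'
      obtain ⟨i, rfl⟩ := hsurj s
      obtain ⟨j, rfl⟩ := hsurj t
      exact ⟨j - i, fun h0 => hne (by rw [sub_eq_zero.1 h0]), fun hd => hst ((hmemD i j).1 hd)⟩
    · rw [hmemD, hmemD, heπ, heπ]
      exact hinv h hh _ _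
  obtain ⟨i, hix⟩ := hsurj x
  obtain ⟨j, hjy⟩ := hsurj y
  have hi : a * i + b = i := by
    rw [← hab]
    exact hbij.injective (by rw [heπ, hix, hx])
  have hj : a * j + b = j := by
    rw [← hab]
    exact hbij.injective (by rw [heπ, hjy, hy])
  have hij : i - j ≠ 0 := fun h0 => hxy (by rw [← hix, ← hjy, sub_eq_zero.1 h0])
  have ha : a = 1 := mul_right_cancel₀ hij (by linear_combination hi - hj)
  have hb : b = 0 := by linear_combination hi - i * ha
  ext z
  obtain ⟨k, rfl⟩ := hsurj z
  rw [← heπ, hab, ha, hb, one_mul, add_zero, Equiv.Perm.one_apply]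

/-- In a non-complete graph whose local graphs have edges, an automorphism fixing `u` and two of its
neighbours fixes all neighbours of `u`. -/
lemma fixes_neighbors_of_fixes_two {V : Type*} [Finite V] {Γ : SimpleGraph V} {p : ℕ}
    (hp : p.Prime) {u : V} (hcard : Nat.card (Γ.neighborSet u) = p) (harc : ArcTransitive Γ)
    (hadj : ∃ a b, Γ.Adj u a ∧ Γ.Adj u b ∧ Γ.Adj a b)
    (hnadj : ∃ a b, Γ.Adj u a ∧ Γ.Adj u b ∧ a ≠ b ∧ ¬ Γ.Adj a b)
    {φ : Γ ≃g Γ} (hφ : φ u = u) {x y : V} (hux : Γ.Adj u x) (huy : Γ.Adj u y) (hxy : x ≠ y)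
    (hx : φ x = x) (hy : φ y = y) {z : V} (hz : Γ.Adj u z) : φ z = z := by
  let H : Subgroup (Equiv.Perm (Γ.neighborSet u)) :=
    { carrier := {σ | ∃ ψ : Γ ≃g Γ, ψ u = u ∧ ∀ x, (σ x : V) = ψ x}
      mul_mem' := by
        rintro σ τ ⟨ψ, hψ, h⟩ ⟨χ, hχ, h'⟩
        exact ⟨ψ * χ, by rw [RelIso.mul_apply, hχ, hψ], fun x => by
          rw [Equiv.Perm.mul_apply, h, h', RelIso.mul_apply]⟩
      one_mem' := ⟨1, rfl, fun _ => rfl⟩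
      inv_mem' := by
        rintro σ ⟨ψ, hψ, h⟩
        refine ⟨ψ⁻¹, ?_, fun x => ψ.injective ?_⟩
        · conv_lhs => rw [← hψ]
          exact RelIso.inv_apply_self ψ u
        · rw [← h, RelIso.apply_inv_self]
          simp }
  have lift : ∀ ψ : Γ ≃g Γ, ψ u = u → ∃ σ ∈ H, ∀ x, (σ x : V) = ψ x := fun ψ hψ => by
    refine ⟨ψ.toEquiv.subtypeEquiv fun a => ?_, ⟨ψ, hψ, fun x => rfl⟩, fun x => rfl⟩
    rw [SimpleGraph.mem_neighborSet, SimpleGraph.mem_neighborSet]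
    conv_rhs => rw [← hψ]
    exact ψ.map_adj_iff.symm
  obtain ⟨σ, hσH, hσ⟩ := lift φ hφ
  obtain ⟨a, b, hua, hub, hab⟩ := hadj
  obtain ⟨a', b', hua', hub', hne, hab'⟩ := hnadj
  have := eq_one_of_fixes_two hp hcard (H := H) (R := fun s t => Γ.Adj s t)
    (fun s t => by
      obtain ⟨ψ, hψ, hst⟩ := harc s.2 t.2
      obtain ⟨τ, hτ, h⟩ := lift ψ hψ
      exact ⟨τ, hτ, Subtype.ext ((h s).trans hst)⟩)
    (fun s => Γ.loopless.irrefl _)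
    (by
      rintro τ ⟨ψ, -, h⟩ s t
      rw [h, h]
      exact ψ.map_adj_iff.symm)
    ⟨⟨a, hua⟩, ⟨b, hub⟩, hab⟩
    ⟨⟨a', hua'⟩, ⟨b', hub'⟩, fun h => hne (congrArg Subtype.val h), hab'⟩
    hσH (x := ⟨x, hux⟩) (y := ⟨y, huy⟩) (fun h => hxy (congrArg Subtype.val h))
    (Subtype.ext ((hσ _).trans hx)) (Subtype.ext ((hσ _).trans hy))
  rw [← hσ ⟨z, hz⟩, this]
  rfl

lemma exists_is2Geodesic {V : Type*} {Γ : SimpleGraph V} (hconn : Γ.Connected) (hnc : Γ ≠ ⊤) :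
    ∃ v u w, Is2Geodesic Γ v u w := by
  by_contra! hcon
  refine hnc (top_le_iff.1 fun a b hab => ?_)
  have hab : a ≠ b := hab
  obtain ⟨W⟩ := hconn.preconnected a b
  have key : ∀ {x y : V} (W : Γ.Walk x y), x = y ∨ Γ.Adj x y := by
    intro x y W
    induction W with
    | nil => exact Or.inl rfl
    | @cons x y z hxy _ ih =>
      by_contra hne
      rw [not_or] at hne
      rcases ih with rfl | hyz
      · exact hne.2 hxy
      · exact hcon x y z ⟨hxy, hyz, hne.1, hne.2⟩
  exact (key W).resolve_left hab

lemma exists_triangle {V : Type*} {Γ : SimpleGraph V} (h2gt : TwoGeodesicTransitive Γ)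
    (h2at : ¬ TwoArcTransitive Γ) : ∃ a b c, Γ.Adj a b ∧ Γ.Adj b c ∧ Γ.Adj a c := by
  by_contra! hcon
  exact h2at ⟨h2gt.1, fun v u w v' u' w' h h' =>
    h2gt.2 ⟨h.1, h.2.1, h.2.2, hcon v u w h.1 h.2.1⟩ ⟨h'.1, h'.2.1, h'.2.2, hcon _ _ _ h'.1 h'.2.1⟩⟩

lemma fixes_all_of_fixes_neighbors {V : Type*} {Γ : SimpleGraph V} (hconn : Γ.Connected)
    (htri : ∀ x y, Γ.Adj x y → ∃ z, Γ.Adj x z ∧ Γ.Adj y z) {φ : Γ ≃g Γ}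
    (hloc : ∀ u x y, φ u = u → Γ.Adj u x → Γ.Adj u y → x ≠ y → φ x = x → φ y = y →
      ∀ z, Γ.Adj u z → φ z = z)
    {v : V} (hv : φ v = v) (hfix : ∀ u, Γ.Adj v u → φ u = u) (x : V) : φ x = x := by
  obtain ⟨W⟩ := hconn.preconnected v x
  induction W with
  | nil => exact hv
  | @cons v u x hvu _ ih =>
    have hu := hfix u hvu
    obtain ⟨z, hvz, huz⟩ := htri v u hvu
    exact ih hu (hloc u v z hu hvu.symm huz hvz.ne hv (hfix z hvz))

/-- The neighbours of `v` other than `u` which are not adjacent to `u`. -/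
def nonadjacentNeighbors {V : Type*} (Γ : SimpleGraph V) (v u : V) : Set V :=
  {x | Γ.Adj v x ∧ x ≠ u ∧ ¬ Γ.Adj u x}

lemma ncard_nonadjacentNeighbors_eq {V : Type*} {Γ : SimpleGraph V} (harc : ArcTransitive Γ)
    {v u v' u' : V} (h : Γ.Adj v u) (h' : Γ.Adj v' u') :
    (nonadjacentNeighbors Γ v' u').ncard = (nonadjacentNeighbors Γ v u).ncard := by
  obtain ⟨φ, rfl, rfl⟩ := harc h h'
  rw [← Set.ncard_image_of_injective (nonadjacentNeighbors Γ v u) φ.injective]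
  congr 1
  ext x
  obtain ⟨x, rfl⟩ := φ.surjective x
  rw [φ.injective.mem_set_image]
  simp [nonadjacentNeighbors, φ.map_adj_iff]

lemma ncard_insert_nonadjacentNeighbors {V : Type*} [Finite V] {Γ : SimpleGraph V} (v u : V) :
    (insert u (nonadjacentNeighbors Γ v u)).ncard = (nonadjacentNeighbors Γ v u).ncard + 1 :=
  Set.ncard_insert_of_notMem fun h => h.2.1 rfl

/-- In a graph of prime valency `p` whose edges have `k` nonadjacent neighbours on each side, with
`3 * k < p`, the number of common neighbours of vertices at distance two cannot divide `p * k`. -/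
lemma false_of_card_common_neighbors_dvd {V : Type*} [Finite V] {Γ : SimpleGraph V} {p k : ℕ}
    (hp : p.Prime) (hreg : ∀ v : V, (Γ.neighborSet v).ncard = p) (hk : 0 < k) (hkp : 3 * k < p)
    (hN : ∀ v u, Γ.Adj v u → (nonadjacentNeighbors Γ v u).ncard = k)
    (hdvd : ∀ v u w, Is2Geodesic Γ v u w →
      (Γ.neighborSet v ∩ Γ.neighborSet w).ncard ∣ p * k) (u : V) : False := by
  classical
  have htwin : ∀ v u w, Is2Geodesic Γ v u w → Γ.neighborSet w = Γ.neighborSet v := by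
    intro v u w hg
    have hc := hdvd v u w hg
    obtain ⟨hvu, huw, hne, hvw⟩ := hg
    set A := insert v (nonadjacentNeighbors Γ u v) with hA
    set B := insert w (nonadjacentNeighbors Γ u w) with hB
    set C := Γ.neighborSet v ∩ Γ.neighborSet w with hC
    have hAc : A.ncard = k + 1 := by
      rw [hA, ncard_insert_nonadjacentNeighbors, hN u v hvu.symm]
    have hBc : B.ncard = k + 1 := by
      rw [hB, ncard_insert_nonadjacentNeighbors, hN u w huw]
    have hinter : 2 ≤ (A ∩ B).ncard := by
      rw [← Set.ncard_pair hne]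
      refine Set.ncard_le_ncard ?_
      rintro x (rfl | rfl)
      · exact ⟨Or.inl rfl, Or.inr ⟨hvu.symm, hne, fun h => hvw h.symm⟩⟩
      · exact ⟨Or.inr ⟨huw, hne.symm, hvw⟩, Or.inl rfl⟩
    have huC : u ∈ C := ⟨hvu, huw.symm⟩
    have hcover : Γ.neighborSet u ⊆ (A ∪ B) ∪ (C \ {u}) := by
      intro x hx
      have hux : Γ.Adj u x := hx
      simp only [hA, hB, hC, nonadjacentNeighbors, Set.mem_union, Set.mem_insert_iff,
        Set.mem_ofPred_eq, Set.mem_sdiff, Set.mem_inter_iff, SimpleGraph.mem_neighborSet,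
        Set.mem_singleton_iff]
      have := hux.ne'
      tauto
    have h1 := Set.ncard_le_ncard hcover
    have h2 := Set.ncard_union_le (A ∪ B) (C \ {u})
    have h3 := Set.ncard_union_add_ncard_inter A B
    have h4 := Set.ncard_sdiff_singleton_add_one huC
    rw [hreg] at h1
    have hle : C.ncard ≤ p := by
      rw [← hreg v]
      exact Set.ncard_le_ncard Set.inter_subset_left
    have hpC : p ∣ C.ncard := by
      by_contra hnd
      have hcop : Nat.Coprime C.ncard p := ((Nat.Prime.coprime_iff_not_dvd hp).2 hnd).symm
      have := Nat.le_of_dvd hk (hcop.dvd_of_dvd_mul_left hc)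
      omega
    have hCp : p ≤ C.ncard := Nat.le_of_dvd (by omega) hpC
    have e1 : C = Γ.neighborSet v :=
      Set.eq_of_subset_of_ncard_le Set.inter_subset_left (by rw [hreg]; exact hCp)
    have e2 : C = Γ.neighborSet w :=
      Set.eq_of_subset_of_ncard_le Set.inter_subset_right (by rw [hreg]; exact hCp)
    rw [← e1, ← e2]
  have hfin : (Γ.neighborSet u).Finite := Set.toFinite _
  have hdiv : k + 1 ∣ p := by
    rw [← hreg u, Set.ncard_eq_toFinset_card _ hfin,
      Finset.card_eq_sum_card_image (fun x => Γ.neighborSet x)]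
    refine Finset.dvd_sum fun b hb => ?_
    obtain ⟨x, hx, rfl⟩ := Finset.mem_image.1 hb
    have hux : Γ.Adj u x := by simpa using hx
    rw [← hN u x hux, ← ncard_insert_nonadjacentNeighbors, ← Set.ncard_coe_finset]
    refine dvd_of_eq (congrArg Set.ncard ?_)
    ext y
    simp only [Set.mem_insert_iff, nonadjacentNeighbors, Set.mem_ofPred_eq, Finset.coe_filter,
      Set.Finite.mem_toFinset, SimpleGraph.mem_neighborSet]
    constructor
    · rintro (rfl | ⟨huy, hyx, hxy⟩)
      · exact ⟨hux, rfl⟩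
      · exact ⟨huy, htwin x u y ⟨hux.symm, huy, hyx.symm, hxy⟩⟩
    · rintro ⟨huy, he⟩
      refine or_iff_not_imp_left.2 fun hyx => ⟨huy, hyx, fun hxy => ?_⟩
      have : y ∈ Γ.neighborSet y := by
        rw [he]
        exact hxy
      exact Γ.loopless.irrefl _ this
  rcases (Nat.dvd_prime hp).1 hdiv with h | h <;> omega

open MulAction in
lemma card_eq_ncard_orbit_mul {G X : Type*} [Group G] [MulAction G X] (S : Subgroup G) (x : X) :
    Nat.card S = (orbit S x).ncard * Nat.card ↥(stabilizer G x ⊓ S) := by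
  rw [← index_stabilizer, ← Subgroup.relIndex_bot_left, ← Subgroup.relIndex_bot_left, mul_comm,
    ← Subgroup.relIndex_mul_relIndex ⊥ (stabilizer G x ⊓ S) S bot_le inf_le_right,
    Subgroup.inf_relIndex_right]
  rfl

open MulAction in
/-- If point stabilisers in a 2-geodesic transitive graph act semiregularly on the remaining
neighbours, `A_v` has order `p * k` with `k` the number of nonadjacent neighbours on an edge,
and `p - 1` is `2 * k` or at least `3 * k`. -/
lemma card_stabilizer_of_semiregular {V : Type*} [Finite V] {Γ : SimpleGraph V} {p : ℕ}
    (hreg : ∀ v : V, (Γ.neighborSet v).ncard = p) (h2gt : TwoGeodesicTransitive Γ)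
    (hsemi : ∀ (φ : Γ ≃g Γ) (u x y : V), φ u = u → Γ.Adj u x → Γ.Adj u y → x ≠ y → φ x = x →
      φ y = y → φ = 1)
    {v u w z : V} (hg : Is2Geodesic Γ u v w) (hvz : Γ.Adj v z) (huz : Γ.Adj u z) :
    Nat.card (stabilizer (Γ ≃g Γ) v) = p * (nonadjacentNeighbors Γ v u).ncard ∧
    (2 * (nonadjacentNeighbors Γ v u).ncard + 1 = p ∨
      3 * (nonadjacentNeighbors Γ v u).ncard < p) := by
  obtain ⟨huv, hvw, huw, hnuw⟩ := hg
  set K : Subgroup (Γ ≃g Γ) := stabilizer (Γ ≃g Γ) u ⊓ stabilizer (Γ ≃g Γ) v with hK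
  have hmemK : ∀ φ : Γ ≃g Γ, φ ∈ K ↔ φ u = u ∧ φ v = v := fun φ => Iff.rfl
  set k := (nonadjacentNeighbors Γ v u).ncard with hk
  have horb : ∀ x, Γ.Adj v x → x ≠ u → (orbit K x).ncard = Nat.card K := fun x hvx hxu => by
    have hbot : stabilizer (Γ ≃g Γ) x ⊓ K = ⊥ := by
      rw [eq_bot_iff]
      rintro φ ⟨h1, h2⟩
      exact hsemi φ v x u h2.2 hvx huv.symm hxu h1 h2.1
    rw [card_eq_ncard_orbit_mul K x, hbot, Subgroup.card_bot, mul_one]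
  have hkK : Nat.card K = k := by
    rw [← horb w hvw huw.symm, hk]
    congr 1
    ext x
    constructor
    · rintro ⟨⟨φ, hφu, hφv⟩, rfl⟩
      have hφu : φ u = u := hφu
      have hφv : φ v = v := hφv
      refine ⟨?_, ?_, ?_⟩
      · change Γ.Adj v (φ w)
        rwa [← hφv, φ.map_adj_iff]
      · change φ w ≠ u
        rw [← hφu]
        exact φ.injective.ne huw.symm
      · change ¬ Γ.Adj u (φ w)
        rwa [← hφu, φ.map_adj_iff]
    · rintro ⟨hvx, hxu, hux⟩
      obtain ⟨φ, h1, h2, h3⟩ := h2gt.2 ⟨huv, hvw, huw, hnuw⟩ ⟨huv, hvx, hxu.symm, hux⟩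
      exact ⟨⟨φ, h1, h2⟩, h3⟩
  refine ⟨?_, ?_⟩
  · rw [card_eq_ncard_orbit_mul _ u, ← hK, hkK, ← hreg v]
    congr 2
    ext x
    constructor
    · rintro ⟨⟨φ, hφ⟩, rfl⟩
      have hφ : φ v = v := hφ
      change Γ.Adj v (φ u)
      rw [← hφ, φ.map_adj_iff]
      exact huv.symm
    · intro hvx
      obtain ⟨φ, h1, h2⟩ := h2gt.1 huv.symm hvx
      exact ⟨⟨φ, h1⟩, h2⟩
  · set S : Set V := {x | Γ.Adj v x ∧ Γ.Adj u x} with hS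
    have hcount : p = S.ncard + k + 1 := by
      rw [← hreg v, hk, add_assoc, ← ncard_insert_nonadjacentNeighbors, ← Set.ncard_union_eq]
      · congr 1
        ext x
        simp only [hS, nonadjacentNeighbors, SimpleGraph.mem_neighborSet, Set.mem_union,
          Set.mem_ofPred_eq, Set.mem_insert_iff]
        have : x = u → Γ.Adj v x := fun h => h ▸ huv.symm
        tauto
      · rw [Set.disjoint_left]
        rintro x ⟨-, hux⟩ (rfl | h)
        · exact Γ.loopless.irrefl _ hux
        · exact h.2.2 hux
    have hsub : ∀ x ∈ S, orbit K x ⊆ S := by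
      rintro x ⟨hvx, hux⟩ _ ⟨⟨φ, hφu, hφv⟩, rfl⟩
      have hφu : φ u = u := hφu
      have hφv : φ v = v := hφv
      refine ⟨?_, ?_⟩
      · change Γ.Adj v (φ x)
        rwa [← hφv, φ.map_adj_iff]
      · change Γ.Adj u (φ x)
        rwa [← hφu, φ.map_adj_iff]
    have hcard : ∀ x ∈ S, (orbit K x).ncard = k := fun x hx => by
      rw [horb x hx.1 hx.2.ne', hkK]
    have hzS : z ∈ S := ⟨hvz, huz⟩
    by_cases hall : S ⊆ orbit K z
    · have : S = orbit K z := hall.antisymm (hsub z hzS)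
      rw [this, hcard z hzS] at hcount
      omega
    · obtain ⟨y, hyS, hy⟩ := Set.not_subset.1 hall
      have hdisj : Disjoint (orbit K z) (orbit K y) :=
        (orbit.eq_or_disjoint z y).resolve_left fun h => hy (h ▸ mem_orbit_self y)
      have := Set.ncard_le_ncard (Set.union_subset (hsub z hzS) (hsub y hyS))
      rw [Set.ncard_union_eq hdisj, hcard z hzS, hcard y hyS] at this
      omega

open MulAction in
lemma ncard_common_neighbors_dvd {V : Type*} {Γ : SimpleGraph V}
    (h2gt : TwoGeodesicTransitive Γ) {v u w : V} (hg : Is2Geodesic Γ v u w) :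
    (Γ.neighborSet v ∩ Γ.neighborSet w).ncard ∣ Nat.card (stabilizer (Γ ≃g Γ) v) := by
  have hle : stabilizer (Γ ≃g Γ) w ⊓ stabilizer (Γ ≃g Γ) v ≤ stabilizer (Γ ≃g Γ) v :=
    inf_le_right
  refine dvd_trans ?_ (Subgroup.card_dvd_of_le hle)
  rw [card_eq_ncard_orbit_mul _ u]
  refine Dvd.intro _ (congrArg₂ _ (congrArg Set.ncard ?_) rfl)
  obtain ⟨hvu, huw, hne, hvw⟩ := hg
  ext x
  constructor
  · rintro ⟨hvx, hwx⟩
    obtain ⟨φ, h1, h2, h3⟩ := h2gt.2 ⟨hvu, huw, hne, hvw⟩ ⟨hvx, hwx.symm, hne, hvw⟩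
    exact ⟨⟨φ, h3, h1⟩, h2⟩
  · rintro ⟨⟨φ, hφw, hφv⟩, rfl⟩
    have hφw : φ w = w := hφw
    have hφv : φ v = v := hφv
    refine ⟨?_, ?_⟩
    · change Γ.Adj v (φ u)
      rwa [← hφv, φ.map_adj_iff]
    · change Γ.Adj w (φ u)
      rw [← hφw, φ.map_adj_iff]
      exact huw.symm

theorem stmt5 {V : Type*} [Fintype V] (Γ : SimpleGraph V) (p : ℕ)
    (hp : p.Prime)
    (hreg : ∀ v : V, Nat.card (Γ.neighborSet v) = p)
    (hconn : Γ.Connected)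
    (hnc : Γ ≠ ⊤)
    (h2gt : TwoGeodesicTransitive Γ)
    (h2at : ¬ TwoArcTransitive Γ) (v : V) :
    (∀ φ : Γ ≃g Γ, φ v = v → (∀ u : V, Γ.Adj v u → φ u = u) → ∀ x : V, φ x = x) ∧
    Nat.card {φ : Γ ≃g Γ // φ v = v} = p * (p - 1) / 2 := by
  have hreg' : ∀ v : V, (Γ.neighborSet v).ncard = p := hreg
  obtain ⟨a, b, c, hab, hbc, hac⟩ := exists_triangle h2gt h2at
  obtain ⟨a', b', c', hg'⟩ := exists_is2Geodesic hconn hnc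
  have htri : ∀ x y, Γ.Adj x y → ∃ z, Γ.Adj x z ∧ Γ.Adj y z := fun x y hxy => by
    obtain ⟨φ, rfl, rfl⟩ := h2gt.1 hab hxy
    exact ⟨φ c, φ.map_adj_iff.2 hac, φ.map_adj_iff.2 hbc⟩
  have hgeo : ∀ x y, Γ.Adj x y → ∃ z, Is2Geodesic Γ x y z := fun x y hxy => by
    obtain ⟨φ, rfl, rfl⟩ := h2gt.1 hg'.1 hxy
    exact ⟨φ c', hxy, φ.map_adj_iff.2 hg'.2.1, φ.injective.ne hg'.2.2.1,
      fun h => hg'.2.2.2 (φ.map_adj_iff.1 h)⟩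
  have hnbr : ∀ x, ∃ y, Γ.Adj x y := fun x =>
    Set.nonempty_of_ncard_ne_zero (s := Γ.neighborSet x) (by rw [hreg']; exact hp.ne_zero)
  have hloc : ∀ (φ : Γ ≃g Γ) (u x y : V), φ u = u → Γ.Adj u x → Γ.Adj u y → x ≠ y → φ x = x →
      φ y = y → ∀ z, Γ.Adj u z → φ z = z := by
    intro φ u x y hφ hux huy hxy hx hy z hz
    refine fixes_neighbors_of_fixes_two hp (hreg u) h2gt.1 ?_ ?_ hφ hux huy hxy hx hy hz
    · obtain ⟨t, hut, hxt⟩ := htri u x hux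
      exact ⟨x, t, hux, hut, hxt⟩
    · obtain ⟨t, h1, h2, h3, h4⟩ := hgeo x u hux.symm
      exact ⟨x, t, hux, h2, h3, h4⟩
  have hfaith : ∀ (φ : Γ ≃g Γ) (v : V), φ v = v → (∀ u, Γ.Adj v u → φ u = u) →
      ∀ x, φ x = x := fun φ v =>
    fixes_all_of_fixes_neighbors hconn htri (hloc φ)
  refine ⟨fun φ => hfaith φ v, ?_⟩
  have hsemi : ∀ (φ : Γ ≃g Γ) (u x y : V), φ u = u → Γ.Adj u x → Γ.Adj u y → x ≠ y → φ x = x →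
      φ y = y → φ = 1 := fun φ u x y hφ hux huy hxy hx hy =>
    RelIso.ext (hfaith φ u hφ (hloc φ u x y hφ hux huy hxy hx hy))
  have hcard : ∀ x y, Γ.Adj x y →
      Nat.card (MulAction.stabilizer (Γ ≃g Γ) x) = p * (nonadjacentNeighbors Γ x y).ncard ∧
      (2 * (nonadjacentNeighbors Γ x y).ncard + 1 = p ∨
        3 * (nonadjacentNeighbors Γ x y).ncard < p) := fun x y hxy => by
    obtain ⟨w, hw⟩ := hgeo y x hxy.symm
    obtain ⟨z, hxz, hyz⟩ := htri x y hxy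
    exact card_stabilizer_of_semiregular hreg' h2gt hsemi hw hxz hyz
  obtain ⟨u, hvu⟩ := hnbr v
  obtain ⟨h1, h2⟩ := hcard v u hvu
  have hN : ∀ x y, Γ.Adj x y →
      (nonadjacentNeighbors Γ x y).ncard = (nonadjacentNeighbors Γ v u).ncard := fun x y hxy =>
    ncard_nonadjacentNeighbors_eq h2gt.1 hvu hxy
  have hk : 0 < (nonadjacentNeighbors Γ v u).ncard := by
    rw [Set.ncard_pos]
    obtain ⟨w, hw1, hw2, hw3, hw4⟩ := hgeo u v hvu.symm
    exact ⟨w, hw2, hw3.symm, hw4⟩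
  have h2 := h2.resolve_right fun h3 =>
    false_of_card_common_neighbors_dvd hp hreg' hk h3 hN (fun x y z hxyz => by
      rw [← hN x y hxyz.1, ← (hcard x y hxyz.1).1]
      exact ncard_common_neighbors_dvd h2gt hxyz) v
  refine Eq.trans h1 (Nat.div_eq_of_eq_mul_left two_pos ?_).symm
  have : p - 1 = (nonadjacentNeighbors Γ v u).ncard * 2 := by omega
  rw [this, mul_assoc]
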